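/- arXiv:math/0702192 — 2 statements merged into one kernel-verified Lean document; each statement's English description precedes it below -/
import Mathlib

section
/- Let s̲₁⋯s̲ₖ be a reduced S̲-expression for w ∈ I(θ), and for 0 ≤ i ≤ k write u_i = e·s̲₁⋯s̲_i (with u₀ = e). Then the number of indices i ∈ {1,…,k} such that u_i = u_{i−1}s_i (equivalently, θ(s_i)u_{i−1}s_i = u_{i−1}) equals 2k − ℓ(w). In particular this number equals 2ρ(w) − ℓ(w) and is independent of the chosen reduced S̲-expression. -/
namespace TwistedIdentitiesPaper

open scoped Classical

variable {B : Type*} {W : Type*} [Group W] {M : CoxeterMatrix B}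

/-- The Bruhat order on `W`, defined via the subword property: `u ≤ v` iff every
reduced expression for `v` contains a subword representing `u`. -/
def bruhatLE (cs : CoxeterSystem M W) (u v : W) : Prop :=
  ∀ l : List B, cs.IsReduced l → cs.wordProd l = v →
    ∃ l' : List B, l'.Sublist l ∧ cs.wordProd l' = u

/-- The strict Bruhat order. -/
def bruhatLT (cs : CoxeterSystem M W) (u v : W) : Prop :=
  bruhatLE cs u v ∧ u ≠ v

/-- The action `w ↦ w ⋅ s̲ᵢ`: `w ⋅ s̲ᵢ = w sᵢ` if `θ(sᵢ) w sᵢ = w`, and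
`w ⋅ s̲ᵢ = θ(sᵢ) w sᵢ` otherwise. -/
noncomputable def twistAct (cs : CoxeterSystem M W) (θ : W ≃* W) (w : W) (i : B) : W :=
  if θ (cs.simple i) * w * cs.simple i = w then w * cs.simple i
  else θ (cs.simple i) * w * cs.simple i

/-- `e ⋅ s̲₁ ⋯ s̲ₖ` for a word `s₁ ⋯ sₖ`. -/
noncomputable def twistProd (cs : CoxeterSystem M W) (θ : W ≃* W) (l : List B) : W :=
  l.foldl (twistAct cs θ) 1

/-- The set of twisted involutions `I(θ) = {w : θ(w) = w⁻¹}`. -/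
def twistedInvolutions (θ : W ≃* W) : Set W := {w | θ w = w⁻¹}

/-- The set of twisted identities `ι(θ) = {θ(w⁻¹) w : w ∈ W}`. -/
def twistedIdentities (θ : W ≃* W) : Set W := {w | ∃ v : W, w = θ v⁻¹ * v}

/-- The rank `ρ(w)` of a twisted involution: the least `k` such that
`w = e ⋅ s̲₁ ⋯ s̲ₖ`. -/
noncomputable def twistRank (cs : CoxeterSystem M W) (θ : W ≃* W) (w : W) : ℕ :=
  sInf {k | ∃ l : List B, l.length = k ∧ twistProd cs θ l = w}

/-- `θ` has the no-odd-flip (NOF) property: for every `s ∈ S` with `θ(s) ≠ s`,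
the order of `s θ(s)` is even or infinite. -/
def NOF (cs : CoxeterSystem M W) (θ : W ≃* W) : Prop :=
  ∀ i : B, θ (cs.simple i) ≠ cs.simple i →
    Even (orderOf (cs.simple i * θ (cs.simple i))) ∨
      orderOf (cs.simple i * θ (cs.simple i)) = 0


section GeometricRepresentation

open Polynomial.Chebyshev

/-- The Gram matrix entry `-cos (π / m(i, j))`, equal to `-1` when `m(i, j)` is infinite. -/
noncomputable def gramEntry (M : CoxeterMatrix B) (i j : B) : ℝ := -Real.cos (Real.pi / M i j)

theorem gramEntry_self (M : CoxeterMatrix B) (i : B) : gramEntry M i i = 1 := by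
  simp [gramEntry]

theorem gramEntry_comm (M : CoxeterMatrix B) (i j : B) : gramEntry M i j = gramEntry M j i := by
  simp [gramEntry, M.symmetric i j]

/-- The simple root `α_i`, a standard basis vector. -/
noncomputable def simpleRoot (i : B) : B → ℝ := Pi.single i 1

theorem simpleRoot_nonneg (i : B) : 0 ≤ simpleRoot i :=
  Pi.single_nonneg.2 zero_le_one

theorem simpleRoot_self (i : B) : simpleRoot i i = 1 := by simp [simpleRoot]

/-- The coefficients of the simple roots in the images of a simple root under a dihedral group. -/
noncomputable def dihedralCoeff (q : ℝ) : ℕ → ℝ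
  | 0 => 0
  | 1 => 1
  | n + 2 => q * dihedralCoeff q (n + 1) - dihedralCoeff q n

theorem dihedralCoeff_two_cos_mul_sin (φ : ℝ) (n : ℕ) :
    dihedralCoeff (2 * Real.cos φ) n * Real.sin φ = Real.sin (n * φ) := by
  induction n using Nat.twoStepInduction with
  | zero => simp [dihedralCoeff]
  | one => simp [dihedralCoeff]
  | more n ih1 ih2 =>
    rw [dihedralCoeff, sub_mul, mul_assoc, ih1, ih2]
    push_cast
    rw [show (n + 2 : ℝ) * φ = (n + 1) * φ + φ by ring,
      show (n : ℝ) * φ = (n + 1) * φ - φ by ring, Real.sin_add, Real.sin_sub]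
    ring

theorem dihedralCoeff_two (n : ℕ) : dihedralCoeff 2 n = n := by
  induction n using Nat.twoStepInduction with
  | zero => simp [dihedralCoeff]
  | one => simp [dihedralCoeff]
  | more n ih1 ih2 =>
    rw [dihedralCoeff, ih1, ih2]
    push_cast
    ring

theorem neg_two_mul_gramEntry (M : CoxeterMatrix B) (i j : B) :
    -2 * gramEntry M i j = 2 * Real.cos (Real.pi / M i j) := by
  rw [gramEntry]; ring

theorem sin_pi_div_pos {M : CoxeterMatrix B} {i j : B} (hij : i ≠ j) (h0 : M i j ≠ 0) :
    0 < Real.sin (Real.pi / M i j) := by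
  have h2 : 2 ≤ M i j := by have := M.off_diagonal i j hij; omega
  have h2' : (2 : ℝ) ≤ M i j := by exact_mod_cast h2
  apply Real.sin_pos_of_pos_of_lt_pi
  · have := Real.pi_pos; positivity
  · exact div_lt_self Real.pi_pos (by linarith)

theorem dihedralCoeff_nonneg {M : CoxeterMatrix B} {i j : B} (hij : i ≠ j) {n : ℕ}
    (hn : M i j = 0 ∨ n ≤ M i j) : 0 ≤ dihedralCoeff (-2 * gramEntry M i j) n := by
  by_cases h0 : M i j = 0
  · have : (-2 : ℝ) * gramEntry M i j = 2 := by simp [gramEntry, h0]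
    rw [this, dihedralCoeff_two]
    positivity
  have hs := sin_pi_div_pos hij h0
  refine nonneg_of_mul_nonneg_left ?_ hs
  rw [neg_two_mul_gramEntry, dihedralCoeff_two_cos_mul_sin]
  have hn' : (n : ℝ) ≤ M i j := by exact_mod_cast hn.resolve_left h0
  have hM : (0 : ℝ) < M i j := by exact_mod_cast Nat.pos_of_ne_zero h0
  have := Real.pi_pos
  apply Real.sin_nonneg_of_nonneg_of_le_pi
  · positivity
  · rw [← mul_div_assoc, div_le_iff₀ hM]
    nlinarith

variable [Fintype B]

/-- The invariant bilinear form of the geometric representation. -/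
noncomputable def rootForm (M : CoxeterMatrix B) : LinearMap.BilinForm ℝ (B → ℝ) :=
  Matrix.toBilin' (Matrix.of (gramEntry M))

theorem rootForm_simpleRoot (M : CoxeterMatrix B) (i j : B) :
    rootForm M (simpleRoot i) (simpleRoot j) = gramEntry M i j := by
  simp [rootForm, simpleRoot, Matrix.toBilin'_single]

theorem rootForm_comm (M : CoxeterMatrix B) (x y : B → ℝ) : rootForm M x y = rootForm M y x := by
  simp only [rootForm, Matrix.toBilin'_apply, Matrix.of_apply]
  rw [Finset.sum_comm]
  refine Finset.sum_congr rfl fun i _ => Finset.sum_congr rfl fun j _ => ?_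
  rw [gramEntry_comm M j i]
  ring

/-- The coroot of the simple root `α_i`. -/
noncomputable def simpleCoroot (M : CoxeterMatrix B) (i : B) : Module.Dual ℝ (B → ℝ) :=
  (2 : ℝ) • rootForm M (simpleRoot i)

theorem simpleCoroot_apply (M : CoxeterMatrix B) (i : B) (x : B → ℝ) :
    simpleCoroot M i x = 2 * rootForm M (simpleRoot i) x := by
  simp [simpleCoroot]

theorem simpleCoroot_simpleRoot (M : CoxeterMatrix B) (i j : B) :
    simpleCoroot M i (simpleRoot j) = 2 * gramEntry M i j := by
  rw [simpleCoroot_apply, rootForm_simpleRoot]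

theorem simpleCoroot_self (M : CoxeterMatrix B) (i : B) :
    simpleCoroot M i (simpleRoot i) = 2 := by
  rw [simpleCoroot_simpleRoot, gramEntry_self, mul_one]

/-- The product of two simple reflections in the geometric representation has the order
prescribed by the Coxeter matrix. -/
theorem reflection_mul_reflection_pow_eq_one (M : CoxeterMatrix B) (i j : B) :
    (Module.reflection (simpleCoroot_self M i) * Module.reflection (simpleCoroot_self M j)) ^ M i j
      = 1 := by
  by_cases hij : i = j
  · subst hij
    rw [M.diagonal, pow_one]
    exact LinearEquiv.ext (Module.involutive_reflection (simpleCoroot_self M i))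
  have h1 : M i j ≠ 1 := M.off_diagonal i j hij
  have hz : simpleCoroot M i (simpleRoot j) * simpleCoroot M j (simpleRoot i) - 2 =
      2 * Real.cos (2 * (Real.pi / M i j)) := by
    rw [simpleCoroot_simpleRoot, simpleCoroot_simpleRoot, gramEntry_comm M j i, Real.cos_two_mul,
      gramEntry]
    ring
  apply LinearEquiv.ext
  intro z
  rw [Module.reflection_mul_reflection_pow_apply (simpleCoroot_self M i) (simpleCoroot_self M j)
    (M i j) z _ hz.symm]
  rw [LinearEquiv.coe_one, id]
  rcases Nat.lt_or_ge (M i j) 3 with h3 | h3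
  · obtain h | h : M i j = 0 ∨ M i j = 2 := by omega
    · simp [h]
    · have hg : gramEntry M i j = 0 := by simp [gramEntry, h]
      simp only [simpleCoroot_simpleRoot, gramEntry_comm M j i, hg, h]
      have : (2 : ℝ) * Real.cos (2 * (Real.pi / (2 : ℕ))) = -2 := by
        rw [show 2 * (Real.pi / (2 : ℕ)) = Real.pi by push_cast; ring, Real.cos_pi]; ring
      rw [this]
      norm_num
      module
  have hm : (3 : ℝ) ≤ M i j := by exact_mod_cast h3
  have hpi := Real.pi_pos
  set φ : ℝ := 2 * (Real.pi / M i j) with hφ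
  have hφm : φ * M i j = 2 * Real.pi := by rw [hφ]; field_simp
  have hsin : Real.sin φ ≠ 0 := by
    apply ne_of_gt
    apply Real.sin_pos_of_pos_of_lt_pi
    · positivity
    · nlinarith
  have hS : ∀ n : ℤ, (S ℝ n).eval (2 * Real.cos φ) * Real.sin φ = Real.sin ((n + 1) * φ) :=
    fun n => Polynomial.Chebyshev.S_two_mul_real_cos φ n
  rcases Nat.even_or_odd' (M i j) with ⟨k, hk | hk⟩
  · have h0 : (S ℝ ((k : ℤ) - 1)).eval (2 * Real.cos φ) = 0 := by
      apply (mul_eq_zero.1 ((hS _).trans _)).resolve_right hsin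
      have : (((k : ℤ) - 1 : ℤ) + 1 : ℝ) * φ = Real.pi := by
        rw [hk] at hφm; push_cast at hφm ⊢; linarith
      rw [this, Real.sin_pi]
    rw [show (((M i j : ℕ) : ℤ) - 2) / 2 = (k : ℤ) - 1 by omega,
      show (((M i j : ℕ) : ℤ) - 1) / 2 = (k : ℤ) - 1 by omega, h0]
    simp
  · have h0 : (S ℝ (k : ℤ)).eval (2 * Real.cos φ) + (S ℝ ((k : ℤ) - 1)).eval (2 * Real.cos φ)
        = 0 := by
      apply (mul_eq_zero.1 (Eq.trans _ (Eq.refl 0))).resolve_right hsin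
      rw [add_mul, hS, hS]
      have : ((k : ℤ) + 1 : ℝ) * φ = 2 * Real.pi - (((k : ℤ) - 1 : ℤ) + 1 : ℝ) * φ := by
        rw [hk] at hφm; push_cast at hφm ⊢; linarith
      rw [this, Real.sin_two_pi_sub]
      ring
    rw [show (((M i j : ℕ) : ℤ) - 2) / 2 = (k : ℤ) - 1 by omega,
      show (((M i j : ℕ) : ℤ) - 1) / 2 = (k : ℤ) by omega,
      show (((M i j : ℕ) : ℤ) - 3) / 2 = (k : ℤ) - 1 by omega,
      show (((M i j : ℕ) : ℤ)) / 2 = (k : ℤ) by omega, h0]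
    simp

theorem isLiftable_reflection (M : CoxeterMatrix B) :
    M.IsLiftable fun i => (Module.reflection (simpleCoroot_self M i)).toLinearMap := by
  intro i j
  have h := congrArg (LinearEquiv.automorphismGroup.toLinearMapMonoidHom (R := ℝ) (M := B → ℝ))
    (reflection_mul_reflection_pow_eq_one M i j)
  rwa [map_pow, map_mul, map_one] at h

/-- The geometric representation of a Coxeter group. -/
noncomputable def geomRep (cs : CoxeterSystem M W) : W →* Module.End ℝ (B → ℝ) :=
  cs.lift ⟨_, isLiftable_reflection M⟩

theorem geomRep_simple (cs : CoxeterSystem M W) (i : B) (x : B → ℝ) :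
    geomRep cs (cs.simple i) x = x - simpleCoroot M i x • simpleRoot i := by
  rw [geomRep, cs.lift_apply_simple]
  exact Module.reflection_apply (y := x) (simpleCoroot_self M i)

theorem geomRep_mul_apply (cs : CoxeterSystem M W) (u v : W) (x : B → ℝ) :
    geomRep cs (u * v) x = geomRep cs u (geomRep cs v x) := by
  rw [map_mul, Module.End.mul_apply]

theorem geomRep_simple_simpleRoot (cs : CoxeterSystem M W) (i : B) :
    geomRep cs (cs.simple i) (simpleRoot i) = -simpleRoot i := by
  rw [geomRep_simple, simpleCoroot_self]
  module

theorem rootForm_geomRep (cs : CoxeterSystem M W) (w : W) (x y : B → ℝ) :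
    rootForm M (geomRep cs w x) (geomRep cs w y) = rootForm M x y := by
  induction w using cs.simple_induction_left generalizing x y with
  | one => simp
  | mul_simple_left w i ih =>
    rw [geomRep_mul_apply, geomRep_mul_apply, geomRep_simple, geomRep_simple, ← ih x y]
    simp only [map_sub, map_smul, LinearMap.sub_apply, LinearMap.smul_apply, smul_eq_mul,
      rootForm_comm M _ (simpleRoot i), rootForm_simpleRoot, gramEntry_self, simpleCoroot_apply]
    ring

theorem geomRep_alternatingWord (cs : CoxeterSystem M W) (i j : B) (n : ℕ) :
    geomRep cs (cs.wordProd (CoxeterSystem.alternatingWord i j n)) (simpleRoot i) =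
      dihedralCoeff (-2 * gramEntry M i j) (if Even n then n + 1 else n) • simpleRoot i +
      dihedralCoeff (-2 * gramEntry M i j) (if Even n then n else n + 1) • simpleRoot j := by
  induction n with
  | zero => simp [CoxeterSystem.alternatingWord, dihedralCoeff]
  | succ n ih =>
    rw [CoxeterSystem.alternatingWord_succ', cs.wordProd_cons, geomRep_mul_apply, ih]
    by_cases hn : Even n
    · have hn' : ¬ Even (n + 1) := by simpa [Nat.even_add_one] using hn
      simp only [if_pos hn, if_neg hn', geomRep_simple, map_add, map_smul,
        simpleCoroot_simpleRoot, gramEntry_self, gramEntry_comm M j i, dihedralCoeff]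
      module
    · have hn' : Even (n + 1) := by simpa [Nat.even_add_one] using hn
      simp only [if_neg hn, if_pos hn', geomRep_simple, map_add, map_smul,
        simpleCoroot_simpleRoot, gramEntry_self, dihedralCoeff]
      module

end GeometricRepresentation

section Positivity

theorem exists_maximal_alternating_suffix (cs : CoxeterSystem M W) {w : W} {i j : B}
    (hj : cs.IsRightDescent w j) :
    ∃ v n, 1 ≤ n ∧ w = v * cs.wordProd (CoxeterSystem.alternatingWord i j n) ∧
      cs.length w = cs.length v + n ∧ ¬ cs.IsRightDescent v i ∧ ¬ cs.IsRightDescent v j := by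
  set P : ℕ → Prop := fun n => ∃ v, w = v * cs.wordProd (CoxeterSystem.alternatingWord i j n) ∧
    cs.length w = cs.length v + n with hP
  have hP1 : P 1 := by
    refine ⟨w * cs.simple j, ?_, ?_⟩
    · simp [CoxeterSystem.alternatingWord]
    · exact (cs.isRightDescent_iff.1 hj).symm
  have hbound : ∀ n, P n → n ≤ cs.length w := by
    rintro n ⟨v, -, h⟩
    omega
  have hle : 1 ≤ cs.length w := hbound 1 hP1
  set n := Nat.findGreatest P (cs.length w) with hn
  have hPn : P n := Nat.findGreatest_spec hle hP1
  have hn1 : 1 ≤ n := Nat.le_findGreatest hle hP1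
  have hmax : ¬ P (n + 1) := fun h => by
    have := Nat.le_findGreatest (hbound _ h) h
    omega
  obtain ⟨v, hv, hlen⟩ := hPn
  have hnext : ¬ cs.IsRightDescent v (if Even n then j else i) := fun h => by
    refine hmax ⟨v * cs.simple (if Even n then j else i), ?_, ?_⟩
    · rw [CoxeterSystem.alternatingWord_succ', cs.wordProd_cons, ← mul_assoc,
        cs.simple_mul_simple_cancel_right, hv]
    · have := cs.isRightDescent_iff.1 h
      omega
  have hprev : ¬ cs.IsRightDescent v (if Even n then i else j) := fun h => by
    obtain ⟨k, hk⟩ : ∃ k, n = k + 1 := ⟨n - 1, by omega⟩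
    have hpar : (if Even n then i else j) = if Even k then j else i := by
      rw [hk]
      by_cases hke : Even k <;> simp [hke, Nat.even_add_one]
    rw [hpar] at h
    have hw : w = v * cs.simple (if Even k then j else i) *
        cs.wordProd (CoxeterSystem.alternatingWord i j k) := by
      rw [hv, hk, CoxeterSystem.alternatingWord_succ', cs.wordProd_cons, mul_assoc]
    have h1 := cs.length_mul_le (v * cs.simple (if Even k then j else i))
      (cs.wordProd (CoxeterSystem.alternatingWord i j k))
    have h2 := cs.length_wordProd_le (CoxeterSystem.alternatingWord i j k)
    rw [CoxeterSystem.length_alternatingWord] at h2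
    rw [← hw] at h1
    have := cs.isRightDescent_iff.1 h
    omega
  refine ⟨v, n, hn1, hv, hlen, ?_⟩
  by_cases he : Even n
  · rw [if_pos he] at hnext hprev
    exact ⟨hprev, hnext⟩
  · rw [if_neg he] at hnext hprev
    exact ⟨hnext, hprev⟩

theorem lt_of_not_isRightDescent_mul_alternatingWord (cs : CoxeterSystem M W) {v w : W} {i j : B}
    {n : ℕ} (hw : w = v * cs.wordProd (CoxeterSystem.alternatingWord i j n))
    (hlen : cs.length w = cs.length v + n) (hi : ¬ cs.IsRightDescent w i) (hM : M i j ≠ 0) :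
    n < M i j := by
  have hred : cs.IsReduced (CoxeterSystem.alternatingWord i j n) := by
    have h1 := cs.length_mul_le v (cs.wordProd (CoxeterSystem.alternatingWord i j n))
    have h2 := cs.length_wordProd_le (CoxeterSystem.alternatingWord i j n)
    rw [← hw] at h1
    rw [CoxeterSystem.IsReduced]
    rw [CoxeterSystem.length_alternatingWord] at h2 ⊢
    omega
  by_contra hcon
  rcases Nat.lt_or_ge (M i j) n with h | h
  · exact cs.not_isReduced_alternatingWord i j hM h hred
  have hn : n = M i j := by omega
  obtain ⟨k, hk⟩ : ∃ k, M i j = k + 1 := ⟨M i j - 1, by omega⟩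
  have hbraid := cs.wordProd_braidWord_eq i j
  rw [CoxeterSystem.braidWord, CoxeterSystem.braidWord, ← M.symmetric i j] at hbraid
  have hws : w * cs.simple i = v * cs.wordProd (CoxeterSystem.alternatingWord i j k) := by
    rw [hw, hn, hbraid, hk, CoxeterSystem.alternatingWord_succ, cs.wordProd_concat, mul_assoc,
      cs.simple_mul_simple_cancel_right]
  have h1 := cs.length_mul_le v (cs.wordProd (CoxeterSystem.alternatingWord i j k))
  have h2 := cs.length_wordProd_le (CoxeterSystem.alternatingWord i j k)
  rw [CoxeterSystem.length_alternatingWord] at h2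
  rw [← hws] at h1
  have := cs.not_isRightDescent_iff.1 hi
  omega

variable [Fintype B]

/-- If `ℓ(w s_i) > ℓ(w)` then `w` sends the simple root `α_i` to a positive root. -/
theorem geomRep_simpleRoot_nonneg (cs : CoxeterSystem M W) {w : W} {i : B}
    (hi : ¬ cs.IsRightDescent w i) : 0 ≤ geomRep cs w (simpleRoot i) := by
  induction hk : cs.length w using Nat.strong_induction_on generalizing w i with
  | _ k ih =>
  by_cases hw1 : w = 1
  · simpa [hw1] using simpleRoot_nonneg i
  obtain ⟨j, hj⟩ := cs.exists_rightDescent_of_ne_one hw1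
  have hij : i ≠ j := by rintro rfl; exact hi hj
  obtain ⟨v, n, hn, hv, hlen, hvi, hvj⟩ := exists_maximal_alternating_suffix cs (i := i) hj
  have hlt : M i j = 0 ∨ n + 1 ≤ M i j := by
    by_cases hM : M i j = 0
    · exact Or.inl hM
    · exact Or.inr (lt_of_not_isRightDescent_mul_alternatingWord cs hv hlen hi hM)
  have hpi := ih _ (by omega) hvi rfl
  have hpj := ih _ (by omega) hvj rfl
  rw [hv, geomRep_mul_apply, geomRep_alternatingWord, map_add, map_smul, map_smul]
  refine add_nonneg (smul_nonneg (dihedralCoeff_nonneg hij ?_) hpi)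
    (smul_nonneg (dihedralCoeff_nonneg hij ?_) hpj)
  all_goals
    refine hlt.imp_right fun h => ?_
    split_ifs <;> omega

theorem geomRep_simpleRoot_nonpos (cs : CoxeterSystem M W) {w : W} {i : B}
    (hi : cs.IsRightDescent w i) : geomRep cs w (simpleRoot i) ≤ 0 := by
  have h := geomRep_simpleRoot_nonneg cs (cs.isRightDescent_iff_not_isRightDescent_mul.1 hi)
  rw [geomRep_mul_apply, geomRep_simple_simpleRoot, map_neg] at h
  exact neg_nonneg.1 h

theorem geomRep_injective (cs : CoxeterSystem M W) : Function.Injective (geomRep cs) := by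
  have key : ∀ w, geomRep cs w = 1 → w = 1 := by
    intro w hw
    by_contra hne
    obtain ⟨i, hi⟩ := cs.exists_rightDescent_of_ne_one hne
    have h := geomRep_simpleRoot_nonpos cs hi i
    rw [hw, Module.End.one_apply, simpleRoot_self] at h
    exact absurd h (by norm_num)
  intro a b hab
  refine (inv_mul_eq_one.1 (key _ ?_))
  rw [map_mul, ← hab, ← map_mul, inv_mul_cancel, map_one]

theorem simple_injective (cs : CoxeterSystem M W) : Function.Injective cs.simple := by
  intro i j hij
  by_contra hne
  have h := geomRep_simple_simpleRoot cs i
  rw [hij, geomRep_simple] at h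
  have h' := congrFun h i
  simp [simpleRoot, hne] at h'
  norm_num at h'

theorem dvd_of_simple_mul_simple_pow_eq_one (cs : CoxeterSystem M W) {i j : B} {n : ℕ}
    (h : (cs.simple i * cs.simple j) ^ n = 1) : M i j ∣ n := by
  by_cases hij : i = j
  · subst hij
    simp
  have hword : cs.wordProd (CoxeterSystem.alternatingWord i j (2 * n)) = 1 := by
    rw [cs.prod_alternatingWord_eq_mul_pow]
    simp [h]
  have hrep := geomRep_alternatingWord cs i j (2 * n)
  rw [hword, map_one, Module.End.one_apply, if_pos (even_two_mul n), if_pos (even_two_mul n)]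
    at hrep
  have h1 : dihedralCoeff (-2 * gramEntry M i j) (2 * n + 1) = 1 := by
    have := congrFun hrep i
    simpa [simpleRoot, hij] using this.symm
  have h0 : dihedralCoeff (-2 * gramEntry M i j) (2 * n) = 0 := by
    have := congrFun hrep j
    simpa [simpleRoot, Ne.symm hij] using this.symm
  by_cases hM : M i j = 0
  · have hq : (-2 : ℝ) * gramEntry M i j = 2 := by simp [gramEntry, hM]
    rw [hq, dihedralCoeff_two] at h0
    have : 2 * n = 0 := by exact_mod_cast h0
    rw [show n = 0 by omega]
    exact dvd_zero _
  have hs := sin_pi_div_pos hij hM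
  have e1 := dihedralCoeff_two_cos_mul_sin (Real.pi / M i j) (2 * n + 1)
  have e0 := dihedralCoeff_two_cos_mul_sin (Real.pi / M i j) (2 * n)
  rw [← neg_two_mul_gramEntry, h1, one_mul] at e1
  rw [← neg_two_mul_gramEntry, h0, zero_mul] at e0
  rw [Nat.cast_add, Nat.cast_one, add_mul, one_mul, Real.sin_add, ← e0, zero_mul, zero_add] at e1
  have hc : Real.cos ((2 * n : ℕ) * (Real.pi / M i j)) = 1 :=
    (mul_right_cancel₀ hs.ne' ((one_mul _).trans e1)).symm
  obtain ⟨z, hz⟩ := (Real.cos_eq_one_iff _).1 hc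
  have hM' : (M i j : ℝ) ≠ 0 := by exact_mod_cast hM
  have hpi := Real.pi_ne_zero
  have hz' : (n : ℝ) = M i j * z := by
    push_cast at hz
    field_simp at hz
    linarith
  have : (n : ℤ) = M i j * z := by exact_mod_cast hz'
  exact Int.natCast_dvd_natCast.1 ⟨z, this⟩

theorem orderOf_simple_mul_simple (cs : CoxeterSystem M W) (i j : B) :
    orderOf (cs.simple i * cs.simple j) = M i j :=
  Nat.dvd_antisymm (orderOf_dvd_of_pow_eq_one (cs.simple_mul_simple_pow i j))
    (dvd_of_simple_mul_simple_pow_eq_one cs (pow_orderOf_eq_one _))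

theorem simple_mul_eq_mul_simple_of_geomRep (cs : CoxeterSystem M W) {u : W} {i r : B}
    (h : geomRep cs u (simpleRoot i) = simpleRoot r) : cs.simple r * u = u * cs.simple i := by
  apply geomRep_injective cs
  refine LinearMap.ext fun x => ?_
  rw [geomRep_mul_apply, geomRep_mul_apply, geomRep_simple, geomRep_simple, map_sub, map_smul, h,
    simpleCoroot_apply, simpleCoroot_apply, ← h, rootForm_geomRep]

/-- The exchange property in its two-sided form. -/
theorem simple_mul_eq_mul_simple (cs : CoxeterSystem M W) {u : W} {i r : B}
    (hi : ¬ cs.IsRightDescent u i) (hr : ¬ cs.IsLeftDescent u r)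
    (hir : cs.IsLeftDescent (u * cs.simple i) r) : cs.simple r * u = u * cs.simple i := by
  apply simple_mul_eq_mul_simple_of_geomRep
  have hpos := geomRep_simpleRoot_nonneg cs hi
  have hneg : geomRep cs (cs.simple r * u) (simpleRoot i) ≤ 0 := by
    apply geomRep_simpleRoot_nonpos
    rw [cs.not_isRightDescent_iff] at hi
    rw [cs.not_isLeftDescent_iff] at hr
    rw [cs.isLeftDescent_iff, ← mul_assoc] at hir
    rw [CoxeterSystem.IsRightDescent]
    omega
  rw [geomRep_mul_apply, geomRep_simple] at hneg
  set β := geomRep cs u (simpleRoot i) with hβ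
  have hmul : β = β r • simpleRoot r := by
    ext b
    by_cases hb : b = r
    · simp [hb, simpleRoot]
    · have h1 := hpos b
      have h2 := hneg b
      simp only [simpleRoot, Pi.sub_apply, Pi.smul_apply, Pi.single_eq_of_ne hb, smul_zero,
        sub_zero, Pi.zero_apply] at h1 h2 ⊢
      exact le_antisymm h2 h1
  have hnorm : rootForm M β β = 1 := by
    rw [hβ, rootForm_geomRep, rootForm_simpleRoot, gramEntry_self]
  rw [hmul] at hnorm
  simp only [map_smul, LinearMap.smul_apply, rootForm_simpleRoot, gramEntry_self, smul_eq_mul,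
    mul_one] at hnorm
  have h1 : β r = 1 := by
    have := hpos r
    simp only [Pi.zero_apply] at this
    nlinarith
  rw [hmul, h1, one_smul]

end Positivity

section TwistedAction

variable {cs : CoxeterSystem M W} {θ : W ≃* W} {σ : B → B}

theorem length_map_le (hσ : ∀ i, θ (cs.simple i) = cs.simple (σ i)) (w : W) :
    cs.length (θ w) ≤ cs.length w := by
  obtain ⟨ω, hω, rfl⟩ := cs.exists_isReduced w
  have : θ (cs.wordProd ω) = cs.wordProd (ω.map σ) := by
    simp only [CoxeterSystem.wordProd, map_list_prod, List.map_map]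
    congr 1
    exact List.map_congr_left fun i _ => hσ i
  rw [this, hω.eq]
  simpa using cs.length_wordProd_le (ω.map σ)

theorem length_map (hθ : Function.Involutive θ) (hσ : ∀ i, θ (cs.simple i) = cs.simple (σ i))
    (w : W) : cs.length (θ w) = cs.length w :=
  le_antisymm (length_map_le hσ w) ((congrArg cs.length (hθ w)).symm.le.trans (length_map_le hσ _))

theorem twistAct_mem (hθ : Function.Involutive θ) {u : W} (hu : u ∈ twistedInvolutions θ) (i : B) :
    twistAct cs θ u i ∈ twistedInvolutions θ := by
  have hu' : θ u = u⁻¹ := hu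
  have hinv : (θ (cs.simple i))⁻¹ = θ (cs.simple i) := by rw [← map_inv, cs.inv_simple]
  rw [twistAct]
  split_ifs with h
  · change θ _ = _⁻¹
    have h' : u * cs.simple i = θ (cs.simple i) * u := by
      rw [← mul_left_cancel_iff (a := θ (cs.simple i)), ← mul_assoc, h, ← mul_assoc,
        ← map_mul, cs.simple_mul_simple_self, map_one, one_mul]
    rw [map_mul, hu', h', mul_inv_rev, hinv]
  · change θ _ = _⁻¹
    rw [map_mul, map_mul, hθ, hu', mul_inv_rev, mul_inv_rev, hinv, cs.inv_simple, mul_assoc]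

theorem simple_mul_twisted {u : W} {i : B}
    (hfix : θ (cs.simple i) * u * cs.simple i = u) :
    θ (cs.simple i) * u = u * cs.simple i := by
  conv_rhs => rw [← hfix]
  rw [cs.simple_mul_simple_cancel_right]

theorem twistAct_twistAct (u : W) (i : B) :
    twistAct cs θ (twistAct cs θ u i) i = u := by
  have hsq : θ (cs.simple i) * θ (cs.simple i) = 1 := by
    rw [← map_mul, cs.simple_mul_simple_self, map_one]
  by_cases h : θ (cs.simple i) * u * cs.simple i = u
  · have h1 : twistAct cs θ u i = u * cs.simple i := if_pos h
    rw [h1, twistAct, if_pos, cs.simple_mul_simple_cancel_right]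
    rw [← mul_assoc, h]
  · have h1 : twistAct cs θ u i = θ (cs.simple i) * u * cs.simple i := if_neg h
    have h2 : θ (cs.simple i) * (θ (cs.simple i) * u * cs.simple i) * cs.simple i = u := by
      rw [← mul_assoc, ← mul_assoc, hsq, one_mul, cs.simple_mul_simple_cancel_right]
    rw [h1, twistAct, if_neg, h2]
    rw [h2]
    exact fun h' => h h'.symm

theorem length_simple_mul_twisted (hθ : Function.Involutive θ)
    (hσ : ∀ i, θ (cs.simple i) = cs.simple (σ i)) {u : W} (hu : u ∈ twistedInvolutions θ) (i : B) :
    cs.length (cs.simple (σ i) * u) = cs.length (u * cs.simple i) := by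
  have hu' : θ u = u⁻¹ := hu
  rw [← length_map hθ hσ (u * cs.simple i), map_mul, hu', hσ, ← cs.length_inv, mul_inv_rev,
    cs.inv_simple]

theorem twistAct_eq_mul_simple_iff (u : W) (i : B) :
    twistAct cs θ u i = u * cs.simple i ↔ θ (cs.simple i) * u * cs.simple i = u := by
  rw [twistAct]
  split_ifs with h
  · simp [h]
  · refine ⟨fun h' => ?_, fun h' => absurd h' h⟩
    have h1 : θ (cs.simple i) = 1 := by
      rw [mul_assoc] at h'
      exact mul_eq_right.1 h'
    rw [map_eq_one_iff θ θ.injective] at h1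
    have := cs.length_simple i
    rw [h1, cs.length_one] at this
    omega

theorem twistProd_concat (l : List B) (i : B) :
    twistProd cs θ (l ++ [i]) = twistAct cs θ (twistProd cs θ l) i := by
  simp [twistProd]

theorem twistProd_mem (hθ : Function.Involutive θ) (l : List B) :
    twistProd cs θ l ∈ twistedInvolutions θ := by
  induction l using List.reverseRecOn with
  | nil =>
    change θ 1 = 1⁻¹
    simp
  | append_singleton l i ih =>
    rw [twistProd_concat]
    exact twistAct_mem hθ ih i

theorem twistProd_take_succ {l : List B} {n : ℕ} (hn : n < l.length) :
    twistProd cs θ (l.take (n + 1)) = twistAct cs θ (twistProd cs θ (l.take n)) l[n] := by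
  rw [List.take_add_one, List.getElem?_eq_getElem hn, Option.toList_some, twistProd_concat]

theorem funLeft_simpleRoot (hinv : Function.Involutive σ) (i : B) :
    LinearMap.funLeft ℝ ℝ σ (simpleRoot i) = simpleRoot (σ i) := by
  ext b
  simp only [LinearMap.funLeft_apply, simpleRoot, Pi.single_apply]
  congr 1
  exact propext ⟨fun h => by rw [← h, hinv], fun h => by rw [h, hinv]⟩

variable [Fintype B]

theorem length_twisted_conj (hθ : Function.Involutive θ)
    (hσ : ∀ i, θ (cs.simple i) = cs.simple (σ i)) {u : W} (hu : u ∈ twistedInvolutions θ) {i : B}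
    (hi : ¬ cs.IsRightDescent u i) (hne : θ (cs.simple i) * u * cs.simple i ≠ u) :
    cs.length (θ (cs.simple i) * u * cs.simple i) = cs.length u + 2 := by
  have hlen := length_simple_mul_twisted hθ hσ hu i
  rw [hσ] at hne ⊢
  have hr : ¬ cs.IsLeftDescent u (σ i) := by
    rw [CoxeterSystem.IsLeftDescent, hlen]
    exact hi
  rcases cs.length_simple_mul (u * cs.simple i) (σ i) with h | h
  · rw [cs.not_isRightDescent_iff] at hi
    rw [mul_assoc]
    omega
  · have := simple_mul_eq_mul_simple cs hi hr (cs.isLeftDescent_iff.2 h)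
    rw [this, cs.simple_mul_simple_cancel_right] at hne
    exact absurd rfl hne

theorem not_isRightDescent_twistAct (hθ : Function.Involutive θ)
    (hσ : ∀ i, θ (cs.simple i) = cs.simple (σ i)) {u : W} (hu : u ∈ twistedInvolutions θ) {i : B}
    (hi : cs.IsRightDescent u i) : ¬ cs.IsRightDescent (twistAct cs θ u i) i := by
  by_cases hfix : θ (cs.simple i) * u * cs.simple i = u
  · rw [twistAct, if_pos hfix]
    exact cs.isRightDescent_iff_not_isRightDescent_mul.1 hi
  · rw [twistAct, if_neg hfix]
    intro h
    have hlen := length_simple_mul_twisted hθ hσ hu i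
    rw [hσ] at h hfix
    rw [cs.isRightDescent_iff, cs.simple_mul_simple_cancel_right] at h
    have hi' := cs.isRightDescent_iff.1 hi
    have key := simple_mul_eq_mul_simple cs (u := u * cs.simple i) (i := i) (r := σ i)
      (cs.isRightDescent_iff_not_isRightDescent_mul.1 hi)
      (by rw [CoxeterSystem.IsLeftDescent, ← mul_assoc]; omega)
      (by rw [CoxeterSystem.IsLeftDescent, cs.simple_mul_simple_cancel_right]; omega)
    rw [cs.simple_mul_simple_cancel_right, ← mul_assoc] at key
    exact hfix key

/-- The trace of `θ ∘ u` on the geometric representation. -/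
noncomputable def twistTrace (cs : CoxeterSystem M W) (σ : B → B) (u : W) : ℝ :=
  LinearMap.trace ℝ (B → ℝ) (LinearMap.funLeft ℝ ℝ σ * geomRep cs u)

theorem involutive_of_map_simple (hθ : Function.Involutive θ)
    (hσ : ∀ i, θ (cs.simple i) = cs.simple (σ i)) : Function.Involutive σ := fun i =>
  simple_injective cs (by rw [← hσ, ← hσ, hθ])

theorem gramEntry_map (hσ : ∀ i, θ (cs.simple i) = cs.simple (σ i)) (i j : B) :
    gramEntry M (σ i) (σ j) = gramEntry M i j := by
  have : M (σ i) (σ j) = M i j := by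
    rw [← orderOf_simple_mul_simple cs, ← hσ, ← hσ, ← map_mul, MulEquiv.orderOf_eq,
      orderOf_simple_mul_simple]
  rw [gramEntry, gramEntry, this]

theorem simpleCoroot_funLeft (hθ : Function.Involutive θ)
    (hσ : ∀ i, θ (cs.simple i) = cs.simple (σ i)) (i : B) (x : B → ℝ) :
    simpleCoroot M (σ i) (LinearMap.funLeft ℝ ℝ σ x) = simpleCoroot M i x := by
  have h : simpleCoroot M (σ i) ∘ₗ LinearMap.funLeft ℝ ℝ σ = simpleCoroot M i := by
    refine (Pi.basisFun ℝ B).ext fun j => ?_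
    rw [Pi.basisFun_apply]
    change simpleCoroot M (σ i) (LinearMap.funLeft ℝ ℝ σ (simpleRoot j)) =
      simpleCoroot M i (simpleRoot j)
    rw [funLeft_simpleRoot (involutive_of_map_simple hθ hσ), simpleCoroot_simpleRoot,
      simpleCoroot_simpleRoot, gramEntry_map hσ]
  exact LinearMap.congr_fun h x

theorem funLeft_mul_geomRep_simple (hθ : Function.Involutive θ)
    (hσ : ∀ i, θ (cs.simple i) = cs.simple (σ i)) (i : B) :
    LinearMap.funLeft ℝ ℝ σ * geomRep cs (cs.simple i) =
      geomRep cs (cs.simple (σ i)) * LinearMap.funLeft ℝ ℝ σ := by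
  refine LinearMap.ext fun x => ?_
  rw [Module.End.mul_apply, Module.End.mul_apply, geomRep_simple, geomRep_simple, map_sub,
    map_smul, simpleCoroot_funLeft hθ hσ, funLeft_simpleRoot (involutive_of_map_simple hθ hσ)]

theorem twistTrace_conj (hθ : Function.Involutive θ)
    (hσ : ∀ i, θ (cs.simple i) = cs.simple (σ i)) (u : W) (i : B) :
    twistTrace cs σ (θ (cs.simple i) * u * cs.simple i) = twistTrace cs σ u := by
  have hinv := involutive_of_map_simple hθ hσ
  rw [twistTrace, hσ, map_mul (geomRep cs), map_mul (geomRep cs), ← mul_assoc, ← mul_assoc, funLeft_mul_geomRep_simple hθ hσ,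
    hinv, LinearMap.trace_mul_comm, ← mul_assoc, ← mul_assoc, ← map_mul (geomRep cs),
    cs.simple_mul_simple_self, map_one, one_mul, twistTrace]

/-- In a commuting step, `u` maps `α_i` to a multiple `±1` of the twisted simple root, and this
multiple governs the change of the trace. -/
theorem exists_twistTrace_mul_simple (hθ : Function.Involutive θ)
    (hσ : ∀ i, θ (cs.simple i) = cs.simple (σ i)) {u : W} {i : B}
    (hfix : θ (cs.simple i) * u * cs.simple i = u) :
    ∃ c : ℝ, c ^ 2 = 1 ∧ geomRep cs u (simpleRoot i) = c • simpleRoot (σ i) ∧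
      twistTrace cs σ (u * cs.simple i) = twistTrace cs σ u - 2 * c := by
  have hinv := involutive_of_map_simple hθ hσ
  have hcomm : cs.simple (σ i) * u = u * cs.simple i := by
    rw [← hσ]
    exact simple_mul_twisted hfix
  have hβ := congrArg (fun v => geomRep cs v (simpleRoot i)) hcomm
  simp only [geomRep_mul_apply, geomRep_simple_simpleRoot, map_neg] at hβ
  rw [geomRep_simple] at hβ
  set β := geomRep cs u (simpleRoot i) with hβdef
  set c := simpleCoroot M (σ i) β / 2 with hc
  have hmul : β = c • simpleRoot (σ i) := by
    have h2 : (2 : ℝ) • β = simpleCoroot M (σ i) β • simpleRoot (σ i) := by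
      rw [two_smul]
      exact eq_neg_add_iff_add_eq.1 (sub_eq_iff_eq_add.1 hβ)
    rw [hc, div_eq_inv_mul, mul_smul, ← h2, smul_smul]
    norm_num
  refine ⟨c, ?_, hmul, ?_⟩
  · have hnorm : rootForm M β β = 1 := by
      rw [hβdef, rootForm_geomRep, rootForm_simpleRoot, gramEntry_self]
    rw [hmul] at hnorm
    simp only [map_smul, LinearMap.smul_apply, rootForm_simpleRoot, gramEntry_self, smul_eq_mul,
      mul_one] at hnorm
    rw [sq, hnorm]
  · have hsub : LinearMap.funLeft ℝ ℝ σ * geomRep cs (u * cs.simple i) =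
        LinearMap.funLeft ℝ ℝ σ * geomRep cs u -
          (simpleCoroot M i).smulRight (c • simpleRoot i) := by
      refine LinearMap.ext fun x => ?_
      rw [LinearMap.sub_apply, LinearMap.smulRight_apply, Module.End.mul_apply,
        Module.End.mul_apply, geomRep_mul_apply, geomRep_simple, map_sub, map_smul, map_sub,
        map_smul, ← hβdef, hmul, map_smul, funLeft_simpleRoot hinv, hinv]
    rw [twistTrace, hsub, map_sub, LinearMap.trace_smulRight, map_smul, simpleCoroot_self,
      twistTrace, smul_eq_mul, mul_comm c 2]

theorem twistTrace_mul_simple_of_not_isRightDescent (hθ : Function.Involutive θ)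
    (hσ : ∀ i, θ (cs.simple i) = cs.simple (σ i)) {u : W} {i : B}
    (hfix : θ (cs.simple i) * u * cs.simple i = u) (hi : ¬ cs.IsRightDescent u i) :
    twistTrace cs σ (u * cs.simple i) = twistTrace cs σ u - 2 := by
  obtain ⟨c, hc, hroot, htr⟩ := exists_twistTrace_mul_simple hθ hσ hfix
  have hpos := geomRep_simpleRoot_nonneg cs hi (σ i)
  rw [hroot, Pi.smul_apply, simpleRoot_self, Pi.zero_apply, smul_eq_mul, mul_one] at hpos
  have : c = 1 := by nlinarith
  rw [htr, this, mul_one]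

/-- Every twisted involution is reached from the identity by length-increasing steps, whose
number is determined by the length and the trace. -/
theorem exists_twistProd_eq (hθ : Function.Involutive θ)
    (hσ : ∀ i, θ (cs.simple i) = cs.simple (σ i)) {w : W} (hw : w ∈ twistedInvolutions θ) :
    ∃ l : List B, twistProd cs θ l = w ∧
      4 * (l.length : ℝ) = 2 * cs.length w + twistTrace cs σ 1 - twistTrace cs σ w := by
  induction hk : cs.length w using Nat.strong_induction_on generalizing w with
  | _ k ih =>
  by_cases hw1 : w = 1
  · subst hw1
    refine ⟨[], rfl, ?_⟩
    rw [cs.length_one] at hk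
    simp [← hk]
  obtain ⟨i, hi⟩ := cs.exists_rightDescent_of_ne_one hw1
  set v := twistAct cs θ w i with hv
  have hvw : twistAct cs θ v i = w := twistAct_twistAct w i
  have hvm : v ∈ twistedInvolutions θ := twistAct_mem hθ hw i
  have hvi : ¬ cs.IsRightDescent v i := not_isRightDescent_twistAct hθ hσ hw hi
  by_cases hfix : θ (cs.simple i) * v * cs.simple i = v
  · have hw' : w = v * cs.simple i := by rw [← hvw, twistAct, if_pos hfix]
    have hlen : cs.length w = cs.length v + 1 := by
      rw [hw']
      exact cs.not_isRightDescent_iff.1 hvi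
    have htr : twistTrace cs σ w = twistTrace cs σ v - 2 := by
      rw [hw']
      exact twistTrace_mul_simple_of_not_isRightDescent hθ hσ hfix hvi
    obtain ⟨l, hl, hcount⟩ := ih _ (by omega) hvm rfl
    refine ⟨l ++ [i], by rw [twistProd_concat, hl, hvw], ?_⟩
    rw [← hk, hlen, htr]
    simp only [List.length_append, List.length_singleton]
    push_cast
    linarith
  · have hw' : w = θ (cs.simple i) * v * cs.simple i := by rw [← hvw, twistAct, if_neg hfix]
    have hlen : cs.length w = cs.length v + 2 := by
      rw [hw']
      exact length_twisted_conj hθ hσ hvm hvi hfix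
    have htr : twistTrace cs σ w = twistTrace cs σ v := by
      rw [hw', twistTrace_conj hθ hσ]
    obtain ⟨l, hl, hcount⟩ := ih _ (by omega) hvm rfl
    refine ⟨l ++ [i], by rw [twistProd_concat, hl, hvw], ?_⟩
    rw [← hk, hlen, htr]
    simp only [List.length_append, List.length_singleton]
    push_cast
    linarith

/-- The `n`-th step of the word `l` multiplies by a simple reflection on the right only. -/
def IsCommutingStep (cs : CoxeterSystem M W) (θ : W ≃* W) (l : List B) (n : ℕ) : Prop :=
  ∃ h : n < l.length,
    twistProd cs θ (l.take (n + 1)) = twistProd cs θ (l.take n) * cs.simple l[n]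

theorem card_commutingStep_bounds (hθ : Function.Involutive θ)
    (hσ : ∀ i, θ (cs.simple i) = cs.simple (σ i)) (l : List B) {n : ℕ} (hn : n ≤ l.length) :
    cs.length (twistProd cs θ (l.take n)) +
        ((Finset.range n).filter (IsCommutingStep cs θ l)).card ≤ 2 * n ∧
      twistTrace cs σ 1 - twistTrace cs σ (twistProd cs θ (l.take n)) ≤
        2 * (((Finset.range n).filter (IsCommutingStep cs θ l)).card : ℝ) := by
  induction n with
  | zero => simp [twistProd]
  | succ n ih =>
    have hlt : n < l.length := hn
    obtain ⟨ih1, ih2⟩ := ih hlt.le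
    rw [Finset.range_add_one, Finset.filter_insert]
    have hstep := twistProd_take_succ (cs := cs) (θ := θ) hlt
    set u := twistProd cs θ (l.take n)
    by_cases hfix : θ (cs.simple l[n]) * u * cs.simple l[n] = u
    · have hu' : twistProd cs θ (l.take (n + 1)) = u * cs.simple l[n] := by
        rw [hstep, twistAct, if_pos hfix]
      rw [if_pos ⟨hlt, hu'⟩, Finset.card_insert_of_notMem (by simp), hu']
      obtain ⟨c, hc, -, htr⟩ := exists_twistTrace_mul_simple hθ hσ hfix
      have hlen := cs.length_mul_le u (cs.simple l[n])
      rw [cs.length_simple] at hlen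
      refine ⟨by omega, ?_⟩
      rw [htr]
      push_cast
      have : c ≤ 1 := by nlinarith
      linarith
    · have hu' : twistProd cs θ (l.take (n + 1)) =
          θ (cs.simple l[n]) * u * cs.simple l[n] := by
        rw [hstep, twistAct, if_neg hfix]
      have hnot : ¬ IsCommutingStep cs θ l n := by
        rintro ⟨_, h⟩
        rw [hstep] at h
        exact hfix ((twistAct_eq_mul_simple_iff u l[n]).1 h)
      rw [if_neg hnot, hu', twistTrace_conj hθ hσ]
      have hlen := cs.length_mul_le (θ (cs.simple l[n]) * u) (cs.simple l[n])
      have hlen' := cs.length_mul_le (θ (cs.simple l[n])) u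
      rw [cs.length_simple] at hlen
      rw [hσ, cs.length_simple, ← hσ] at hlen'
      exact ⟨by omega, ih2⟩

theorem card_commutingStep_of_reduced (hθ : Function.Involutive θ)
    (hσ : ∀ i, θ (cs.simple i) = cs.simple (σ i)) (l : List B)
    (hred : l.length = twistRank cs θ (twistProd cs θ l)) :
    ((Finset.range l.length).filter (IsCommutingStep cs θ l)).card =
      2 * l.length - cs.length (twistProd cs θ l) := by
  obtain ⟨hle, htr⟩ := card_commutingStep_bounds hθ hσ l le_rfl
  rw [List.take_length] at hle htr
  obtain ⟨l', hl', hcount⟩ := exists_twistProd_eq hθ hσ (twistProd_mem (cs := cs) hθ l)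
  have hmin : l.length ≤ l'.length := by
    rw [hred]
    exact Nat.sInf_le ⟨l', rfl, hl'⟩
  have hmin' : (l.length : ℝ) ≤ l'.length := by exact_mod_cast hmin
  have hge : 2 * (l.length : ℝ) ≤ cs.length (twistProd cs θ l) +
      ((Finset.range l.length).filter (IsCommutingStep cs θ l)).card := by linarith
  have hge' : 2 * l.length ≤ cs.length (twistProd cs θ l) +
      ((Finset.range l.length).filter (IsCommutingStep cs θ l)).card := by exact_mod_cast hge
  omega

end TwistedAction

theorem natCard_commutingStep (cs : CoxeterSystem M W) (θ : W ≃* W) (l : List B) :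
    Nat.card {i : Fin l.length //
        twistProd cs θ (l.take (i.1 + 1)) = twistProd cs θ (l.take i.1) * cs.simple (l.get i)} =
      ((Finset.range l.length).filter (IsCommutingStep cs θ l)).card := by
  rw [← Fintype.card_coe, ← Nat.card_eq_fintype_card]
  refine Nat.card_congr
    { toFun := fun i => ⟨i.1.1, Finset.mem_filter.2 ⟨Finset.mem_range.2 i.1.2, i.1.2, i.2⟩⟩
      invFun := fun n => ⟨⟨n.1, Finset.mem_range.1 (Finset.mem_filter.1 n.2).1⟩,
        (Finset.mem_filter.1 n.2).2.2⟩
      left_inv := fun _ => rfl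
      right_inv := fun _ => rfl }

theorem statement0 [Finite B] (cs : CoxeterSystem M W) (θ : W ≃* W)
    (hθ : Function.Involutive θ)
    (hθS : ∀ i : B, ∃ j : B, θ (cs.simple i) = cs.simple j)
    (w : W) (hw : w ∈ twistedInvolutions θ)
    (l : List B) (hl : twistProd cs θ l = w) (hred : l.length = twistRank cs θ w) :
    Nat.card {i : Fin l.length //
        twistProd cs θ (l.take (i.1 + 1)) = twistProd cs θ (l.take i.1) * cs.simple (l.get i)} =
      2 * l.length - cs.length w ∧
    Nat.card {i : Fin l.length //
        twistProd cs θ (l.take (i.1 + 1)) = twistProd cs θ (l.take i.1) * cs.simple (l.get i)} =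
      2 * twistRank cs θ w - cs.length w := by
  cases nonempty_fintype B
  choose σ hσ using hθS
  subst hl
  rw [← hred, and_self, natCard_commutingStep]
  exact card_commutingStep_of_reduced hθ hσ l hred

end TwistedIdentitiesPaper
end

section
/- If w ∈ ι(θ) and s ∈ D_R(w), then w·s̲ ∈ ι(θ). -/
namespace TwistedIdentitiesPaper

open scoped Classical

variable {B : Type*} {W : Type*} [Group W] {M : CoxeterMatrix B}

theorem functionEnd_mul_apply {α : Type*} (f g : Function.End α) (x : α) :
    (f * g) x = f (g x) := rfl

theorem functionEnd_one_apply {α : Type*} (x : α) : (1 : Function.End α) x = x := rfl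

/-- The generator `sᵢ` acting on pairs `(t, ε)` by `(sᵢ t sᵢ, ε + [t = sᵢ])`. -/
noncomputable def signedConj (cs : CoxeterSystem M W) (i : B) : Function.End (W × ZMod 2) :=
  fun p ↦ (cs.simple i * p.1 * cs.simple i, p.2 + if p.1 = cs.simple i then 1 else 0)

theorem simple_mul_pow_mul_simple (cs : CoxeterSystem M W) (i j : B) (k : ℕ) :
    (cs.simple i * cs.simple j) ^ k * cs.simple j * (cs.simple i * cs.simple j) ^ k =
      cs.simple j := by
  induction k with
  | zero => simp
  | succ k ih =>
    calc _ = (cs.simple i * cs.simple j) * ((cs.simple i * cs.simple j) ^ k * cs.simple j *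
          (cs.simple i * cs.simple j) ^ k) * (cs.simple i * cs.simple j) := by
          nth_rewrite 1 [pow_succ']
          rw [pow_succ]
          simp only [mul_assoc]
      _ = _ := by rw [ih]; simp [mul_assoc]

theorem signedConj_mul_pow_apply (cs : CoxeterSystem M W) (i j : B) (n : ℕ) (t : W)
    (ε : ZMod 2) :
    ((signedConj cs i * signedConj cs j) ^ n) (t, ε) =
      ((cs.simple i * cs.simple j) ^ n * t * ((cs.simple i * cs.simple j) ^ n)⁻¹,
        ε + ∑ k ∈ Finset.range (2 * n),
          if t = cs.simple j * (cs.simple i * cs.simple j) ^ k then 1 else 0) := by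
  induction n with
  | zero =>
    rw [pow_zero, functionEnd_one_apply]
    simp
  | succ n ih =>
    set r := cs.simple i * cs.simple j with hr
    have hrinv : r⁻¹ = cs.simple j * cs.simple i := by simp [hr]
    have hconj := simple_mul_pow_mul_simple cs i j n
    rw [← hr] at hconj
    have hconj' : r ^ n * cs.simple j = cs.simple j * (r ^ n)⁻¹ := by
      rw [eq_mul_inv_iff_mul_eq, hconj]
    have h1 : r ^ n * t * (r ^ n)⁻¹ = cs.simple j ↔ t = cs.simple j * r ^ (2 * n) := by
      rw [mul_inv_eq_iff_eq_mul, two_mul, pow_add, ← mul_right_inj (r ^ n) (b := t),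
        ← mul_assoc (r ^ n), ← mul_assoc, hconj']
      simp [mul_assoc]
    have h2 : cs.simple j * (r ^ n * t * (r ^ n)⁻¹) * cs.simple j = cs.simple i ↔
        t = cs.simple j * r ^ (2 * n + 1) := by
      have : cs.simple j * (r ^ n * t * (r ^ n)⁻¹) * cs.simple j = cs.simple i ↔
          r ^ n * t * (r ^ n)⁻¹ = cs.simple j * r := by
        constructor
        · intro h
          calc _ = cs.simple j * (cs.simple j * (r ^ n * t * (r ^ n)⁻¹) * cs.simple j) *
                cs.simple j := by simp [mul_assoc]
            _ = _ := by rw [h, hr, mul_assoc]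
        · intro h
          rw [h, hr]
          simp [mul_assoc]
      rw [this, mul_inv_eq_iff_eq_mul, ← mul_right_inj (r ^ n) (b := t), ← mul_assoc (r ^ n),
        hconj', show 2 * n + 1 = n + (1 + n) by ring, pow_add, pow_add, pow_one]
      simp [mul_assoc]
    have hstep : ((signedConj cs i * signedConj cs j) ^ (n + 1)) (t, ε) =
        signedConj cs i (signedConj cs j (((signedConj cs i * signedConj cs j) ^ n) (t, ε))) := by
      rw [pow_succ']
      rfl
    rw [hstep, ih, show 2 * (n + 1) = 2 * n + 1 + 1 by ring, Finset.sum_range_succ,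
      Finset.sum_range_succ]
    simp only [signedConj, h1, h2, Prod.mk.injEq]
    refine ⟨?_, by ring⟩
    rw [pow_succ', mul_inv_rev, hrinv, hr]
    simp only [mul_assoc]

theorem isLiftable_signedConj (cs : CoxeterSystem M W) : M.IsLiftable (signedConj cs) := by
  intro i j
  funext ⟨t, ε⟩
  rw [signedConj_mul_pow_apply, cs.simple_mul_simple_pow, two_mul, Finset.sum_range_add]
  simp only [pow_add, cs.simple_mul_simple_pow, one_mul, inv_one, mul_one, CharTwo.add_self_eq_zero,
    add_zero]
  rfl

/-- The parity of the number of occurrences of `t` in the right inversion sequence of any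
word for `w`. -/
noncomputable def inversionParity (cs : CoxeterSystem M W) (w t : W) : ZMod 2 :=
  (cs.lift ⟨signedConj cs, isLiftable_signedConj cs⟩ w (t, 0)).2

theorem lift_signedConj_apply (cs : CoxeterSystem M W) (w t : W) (ε : ZMod 2) :
    cs.lift ⟨signedConj cs, isLiftable_signedConj cs⟩ w (t, ε) =
      (w * t * w⁻¹, ε + inversionParity cs w t) := by
  unfold inversionParity
  induction w using cs.simple_induction_left generalizing ε with
  | one => simp [Function.End.one_def]
  | mul_simple_left w i ih =>
    rw [map_mul, functionEnd_mul_apply, functionEnd_mul_apply, ih, cs.lift_apply_simple]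
    nth_rewrite 2 [ih]
    simp [signedConj, mul_assoc, add_assoc]

theorem inversionParity_mul (cs : CoxeterSystem M W) (a b t : W) :
    inversionParity cs (a * b) t =
      inversionParity cs b t + inversionParity cs a (b * t * b⁻¹) := by
  conv_lhs => rw [inversionParity]
  rw [map_mul, functionEnd_mul_apply, lift_signedConj_apply,
    lift_signedConj_apply, zero_add]

theorem inversionParity_one (cs : CoxeterSystem M W) (t : W) : inversionParity cs 1 t = 0 := by
  simp [inversionParity, functionEnd_one_apply]

theorem inversionParity_simple (cs : CoxeterSystem M W) (i : B) (t : W) :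
    inversionParity cs (cs.simple i) t = if t = cs.simple i then 1 else 0 := by
  simp [inversionParity, cs.lift_apply_simple, signedConj]

theorem mem_rightInvSeq_of_inversionParity_ne_zero (cs : CoxeterSystem M W) (ω : List B) (t : W)
    (h : inversionParity cs (cs.wordProd ω) t ≠ 0) : t ∈ cs.rightInvSeq ω := by
  induction ω with
  | nil => simp [inversionParity_one] at h
  | cons i ω ih =>
    rw [cs.wordProd_cons, inversionParity_mul, inversionParity_simple] at h
    rw [CoxeterSystem.rightInvSeq, List.mem_cons]
    by_cases ht : cs.wordProd ω * t * (cs.wordProd ω)⁻¹ = cs.simple i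
    · left
      rw [← ht]
      group
    · right
      apply ih
      simpa [ht] using h

theorem isRightInversion_of_inversionParity_ne_zero (cs : CoxeterSystem M W) (w t : W)
    (h : inversionParity cs w t ≠ 0) : cs.IsRightInversion w t := by
  obtain ⟨ω, hω, rfl⟩ := cs.exists_isReduced w
  exact cs.isRightInversion_of_mem_rightInvSeq hω
    (mem_rightInvSeq_of_inversionParity_ne_zero cs ω t h)

theorem isRightDescent_iff_inversionParity_ne_zero (cs : CoxeterSystem M W) (w : W) (i : B) :
    cs.IsRightDescent w i ↔ inversionParity cs w (cs.simple i) ≠ 0 := by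
  refine ⟨fun hd h ↦ ?_, fun h ↦ (isRightInversion_of_inversionParity_ne_zero cs w _ h).2⟩
  have h' : inversionParity cs (w * cs.simple i) (cs.simple i) ≠ 0 := by
    simp [inversionParity_mul, inversionParity_simple, h]
  have hlt := (isRightInversion_of_inversionParity_ne_zero cs _ _ h').2
  rw [mul_assoc, cs.simple_mul_simple_self, mul_one] at hlt
  exact lt_asymm hlt hd

theorem length_map_le_s2 (cs : CoxeterSystem M W) (θ : W ≃* W)
    (hθS : ∀ i : B, ∃ j : B, θ (cs.simple i) = cs.simple j) (w : W) :
    cs.length (θ w) ≤ cs.length w := by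
  choose f hf using hθS
  obtain ⟨ω, hω, rfl⟩ := cs.exists_isReduced w
  have hmap : θ (cs.wordProd ω) = cs.wordProd (ω.map f) := by
    simp [CoxeterSystem.wordProd, map_list_prod, Function.comp_def, hf]
  rw [hmap, hω.eq]
  simpa using cs.length_wordProd_le (ω.map f)

theorem length_map_eq (cs : CoxeterSystem M W) (θ : W ≃* W) (hθ : Function.Involutive θ)
    (hθS : ∀ i : B, ∃ j : B, θ (cs.simple i) = cs.simple j) (w : W) :
    cs.length (θ w) = cs.length w := by
  refine le_antisymm (length_map_le_s2 cs θ hθS w) ?_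
  simpa [hθ w] using length_map_le_s2 cs θ hθS (θ w)

/-- A descent of a twisted identity never commutes with it in the twisted sense. -/
theorem map_simple_mul_mul_simple_ne (cs : CoxeterSystem M W) (θ : W ≃* W)
    (hθ : Function.Involutive θ)
    (hθS : ∀ i : B, ∃ j : B, θ (cs.simple i) = cs.simple j)
    {w : W} (hw : w ∈ twistedIdentities θ) {i : B} (hi : cs.IsRightDescent w i) :
    θ (cs.simple i) * w * cs.simple i ≠ w := by
  intro hfix
  obtain ⟨v, hv, hvi⟩ : ∃ v : W, w = θ v⁻¹ * v ∧ ¬ cs.IsRightDescent v i := by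
    obtain ⟨v, hv⟩ := hw
    by_cases hvi : cs.IsRightDescent v i
    · refine ⟨v * cs.simple i, ?_, cs.isRightDescent_iff_not_isRightDescent_mul.1 hvi⟩
      rw [← hfix, hv]
      simp [mul_assoc]
    · exact ⟨v, hv, hvi⟩
  have hconj : v * cs.simple i * v⁻¹ = θ v * θ (cs.simple i) * (θ v)⁻¹ := by
    rw [hv, map_inv] at hfix
    rw [mul_inv_eq_iff_eq_mul, ← mul_left_inj (cs.simple i), mul_assoc v,
      cs.simple_mul_simple_self, mul_one]
    calc v = θ v * ((θ v)⁻¹ * v) := by group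
      _ = θ v * (θ (cs.simple i) * ((θ v)⁻¹ * v) * cs.simple i) := by rw [hfix]
      _ = _ := by simp only [mul_assoc]
  have hvzero : inversionParity cs v (cs.simple i) = 0 := by
    simpa [isRightDescent_iff_inversionParity_ne_zero] using hvi
  rw [isRightDescent_iff_inversionParity_ne_zero, hv, inversionParity_mul, hvzero, zero_add,
    hconj, map_inv] at hi
  have hsum := inversionParity_mul cs (θ v)⁻¹ (θ v) (θ (cs.simple i))
  rw [inv_mul_cancel, inversionParity_one] at hsum
  have hne : inversionParity cs (θ v) (θ (cs.simple i)) ≠ 0 := by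
    intro h
    rw [h, zero_add] at hsum
    exact hi hsum.symm
  have hlt := (isRightInversion_of_inversionParity_ne_zero cs _ _ hne).2
  rw [← map_mul, length_map_eq cs θ hθ hθS, length_map_eq cs θ hθ hθS] at hlt
  exact hvi hlt

theorem statement2 [Finite B] (cs : CoxeterSystem M W) (θ : W ≃* W)
    (hθ : Function.Involutive θ)
    (hθS : ∀ i : B, ∃ j : B, θ (cs.simple i) = cs.simple j)
    (w : W) (hw : w ∈ twistedIdentities θ) (i : B) (hi : cs.IsRightDescent w i) :
    twistAct cs θ w i ∈ twistedIdentities θ := by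
  obtain ⟨v, hv⟩ := id hw
  rw [twistAct, if_neg (map_simple_mul_mul_simple_ne cs θ hθ hθS hw hi)]
  refine ⟨v * cs.simple i, ?_⟩
  rw [hv]
  simp [mul_assoc]

end TwistedIdentitiesPaper
end
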